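/- Let Ω be a nonempty compact metric space with a finite Borel measure μ and N ≥ 1. Let ρ_k and ρ_true be bounded measurable densities on Ω and x_k, x_{k+1} ∈ Ω^N. If the descent step satisfies J_{ρ_k}(x_k) − J_{ρ_k}(x_{k+1}) > 2·C_Ω·sup_{q∈Ω} |ρ_k(q) − ρ_true(q)|, where 0 < C_Ω < ∞, then the true coverage energy strictly decreases: J_{ρ_true}(x_{k+1}) < J_{ρ_true}(x_k). -/

import Mathlib

open MeasureTheory

/-- Voronoi cell of the `i`-th generator of the configuration `x`. -/
def voronoiCell {Ω : Type*} [MetricSpace Ω] {N : ℕ} (x : Fin N → Ω) (i : Fin N) : Set Ω :=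
  {q | ∀ j, dist q (x i) ≤ dist q (x j)}

/-- Coverage energy `J_ρ(x)` of a configuration `x` with importance density `ρ`. -/
noncomputable def coverageEnergy {Ω : Type*} [MetricSpace Ω] [MeasurableSpace Ω] {N : ℕ}
    (μ : Measure Ω) (ρ : Ω → ℝ) (x : Fin N → Ω) : ℝ :=
  ∑ i, ∫ q in voronoiCell x i, ρ q * (dist q (x i)) ^ 2 ∂μ

/-- The geometric constant `C_Ω = sup_{x ∈ Ω^N} Σ_i ∫_{V_i(x)} dist(q,x_i)² dμ`. -/
noncomputable def geomConst {Ω : Type*} [MetricSpace Ω] [MeasurableSpace Ω]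
    (μ : Measure Ω) (N : ℕ) : ℝ :=
  ⨆ x : Fin N → Ω, ∑ i, ∫ q in voronoiCell x i, (dist q (x i)) ^ 2 ∂μ

/-- On a compact space, a bounded measurable density times a squared distance is integrable. -/
theorem integrable_mul_dist_sq {Ω : Type*} [MetricSpace Ω] [MeasurableSpace Ω] [BorelSpace Ω]
    [CompactSpace Ω] (μ : Measure Ω) [IsFiniteMeasure μ] {f : Ω → ℝ} (hf : Measurable f)
    {M : ℝ} (hM : ∀ q, |f q| ≤ M) (a : Ω) :
    Integrable (fun q => f q * (dist q a) ^ 2) μ := by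
  have hd : Measurable fun q : Ω => (dist q a) ^ 2 :=
    Continuous.measurable (by fun_prop)
  refine Integrable.of_bound (hf.mul hd).aestronglyMeasurable
    (M * Metric.diam (Set.univ : Set Ω) ^ 2) (Filter.Eventually.of_forall fun q => ?_)
  have hq : dist q a ≤ Metric.diam (Set.univ : Set Ω) :=
    Metric.dist_le_diam_of_mem isCompact_univ.isBounded (Set.mem_univ q) (Set.mem_univ a)
  have hM0 : 0 ≤ M := (abs_nonneg _).trans (hM q)
  rw [Real.norm_eq_abs, abs_mul, abs_of_nonneg (sq_nonneg (dist q a))]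
  gcongr
  exact hM q

/-- If `f ≤ g + S` pointwise then the coverage energies for `f` and `g` differ by at most
`S` times the geometric constant. -/
theorem coverageEnergy_le_add {Ω : Type*} [MetricSpace Ω] [MeasurableSpace Ω] [BorelSpace Ω]
    [CompactSpace Ω] (μ : Measure Ω) [IsFiniteMeasure μ] {N : ℕ} {f g : Ω → ℝ}
    (hf : Measurable f) (hg : Measurable g) {A B S : ℝ} (hA : ∀ q, |f q| ≤ A)
    (hB : ∀ q, |g q| ≤ B) (hS : 0 ≤ S) (hfg : ∀ q, f q ≤ g q + S)
    (hC : BddAbove (Set.range fun x : Fin N → Ω =>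
      ∑ i, ∫ q in voronoiCell x i, (dist q (x i)) ^ 2 ∂μ))
    (x : Fin N → Ω) :
    coverageEnergy μ f x ≤ coverageEnergy μ g x + S * geomConst μ N := by
  have hx : ∑ i, ∫ q in voronoiCell x i, (dist q (x i)) ^ 2 ∂μ ≤ geomConst μ N := le_ciSup hC x
  refine le_trans ?_ (add_le_add_right (mul_le_mul_of_nonneg_left hx hS) _)
  unfold coverageEnergy
  rw [Finset.mul_sum, ← Finset.sum_add_distrib]
  refine Finset.sum_le_sum fun i _ => ?_
  have hgi := integrable_mul_dist_sq (μ.restrict (voronoiCell x i)) hg hB (x i)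
  have hSi := integrable_mul_dist_sq (μ.restrict (voronoiCell x i))
    (measurable_const (a := S)) (fun _ => le_rfl) (x i)
  rw [← integral_const_mul, ← integral_add hgi hSi]
  refine integral_mono (integrable_mul_dist_sq _ hf hA (x i)) (hgi.add hSi) fun q => ?_
  simp only [← add_mul]
  exact mul_le_mul_of_nonneg_right (hfg q) (sq_nonneg _)

/-- **Monotonic decrease of the true coverage objective.** If the descent achieved by the
Lloyd step (measured in the model density `ρ_k`) exceeds `2 C_Ω ‖ρ_k − ρ_true‖_∞`, then the
true coverage energy strictly decreases. -/
theorem monotone_decrease_true_coverage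
    {Ω : Type*} [MetricSpace Ω] [MeasurableSpace Ω] [BorelSpace Ω]
    [CompactSpace Ω] [Nonempty Ω]
    (μ : Measure Ω) [IsFiniteMeasure μ]
    {N : ℕ} (hN : 1 ≤ N)
    (ρk ρtrue : Ω → ℝ)
    (hmk : Measurable ρk) (hmt : Measurable ρtrue)
    (hnk : ∀ q, 0 ≤ ρk q) (hnt : ∀ q, 0 ≤ ρtrue q)
    (hbk : ∃ M, ∀ q, ρk q ≤ M) (hbt : ∃ M, ∀ q, ρtrue q ≤ M)
    (xk xk1 : Fin N → Ω)
    (hCpos : 0 < geomConst μ N)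
    (hCfin : BddAbove (Set.range fun x : Fin N → Ω =>
      ∑ i, ∫ q in voronoiCell x i, (dist q (x i)) ^ 2 ∂μ))
    (hdescent : 2 * geomConst μ N * (⨆ q, |ρk q - ρtrue q|) <
      coverageEnergy μ ρk xk - coverageEnergy μ ρk xk1) :
    coverageEnergy μ ρtrue xk1 < coverageEnergy μ ρtrue xk := by
  obtain ⟨A, hA⟩ := hbk
  obtain ⟨B, hB⟩ := hbt
  have hA' : ∀ q, |ρk q| ≤ A := fun q => (abs_of_nonneg (hnk q)).trans_le (hA q)
  have hB' : ∀ q, |ρtrue q| ≤ B := fun q => (abs_of_nonneg (hnt q)).trans_le (hB q)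
  have hbdd : BddAbove (Set.range fun q => |ρk q - ρtrue q|) := by
    refine ⟨A + B, ?_⟩
    rintro _ ⟨q, rfl⟩
    exact (abs_sub _ _).trans (add_le_add (hA' q) (hB' q))
  have hS : ∀ q, |ρk q - ρtrue q| ≤ ⨆ q, |ρk q - ρtrue q| := le_ciSup hbdd
  have hS0 : 0 ≤ ⨆ q, |ρk q - ρtrue q| := Real.iSup_nonneg fun _ => abs_nonneg _
  have h₀ := coverageEnergy_le_add μ hmk hmt hA' hB' hS0
    (fun q => by linarith [(abs_le.mp (hS q)).2]) hCfin xk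
  have h₁ := coverageEnergy_le_add μ hmt hmk hB' hA' hS0
    (fun q => by linarith [(abs_le.mp (hS q)).1]) hCfin xk1
  linarith
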